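/- Let S = {s_1, …, s_m} be a finite family of splits satisfying the tree (laminar) condition, and define the fitted values ŷ_i = ȳ + Σ_{j=1}^{m} β_j ψ(i; s_j), where ȳ = n⁻¹ Σ_{i=1}^{n} y_i and β_j = (Σ_{i=1}^{n} y_i ψ(i; s_j)) / |v_j|. Then the explained sum of squares equals the total weighted impurity decrease of the splits: Σ_{i=1}^{n} (ŷ_i − ȳ)² = Σ_{j=1}^{m} |v_j| · Δ̂(s_j). -/

import Mathlib

open Finset

variable {n : ℕ}

/-- Mean response of the training samples in node `v`. -/
noncomputable def nodeMean (y : Fin n → ℝ) (v : Finset (Fin n)) : ℝ :=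
  ((v.card : ℝ))⁻¹ * ∑ i ∈ v, y i

/-- Stump function of the split of a node into children `vL`, `vR`. -/
noncomputable def stump (vL vR : Finset (Fin n)) (i : Fin n) : ℝ :=
  ((vR.card : ℝ) * (if i ∈ vL then (1 : ℝ) else 0)
      - (vL.card : ℝ) * (if i ∈ vR then (1 : ℝ) else 0))
    / Real.sqrt ((vL.card : ℝ) * (vR.card : ℝ))

/-- Impurity decrease of the split of node `vL ∪ vR` into children `vL`, `vR`. -/
noncomputable def impurityDecrease (y : Fin n → ℝ) (vL vR : Finset (Fin n)) : ℝ :=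
  (((vL ∪ vR).card : ℝ))⁻¹ *
    ((∑ i ∈ vL ∪ vR, (y i - nodeMean y (vL ∪ vR)) ^ 2)
      - (∑ i ∈ vL, (y i - nodeMean y vL) ^ 2)
      - (∑ i ∈ vR, (y i - nodeMean y vR) ^ 2))

lemma sum_mul_stump (f : Fin n → ℝ) (A B : Finset (Fin n)) :
    ∑ i, f i * stump A B i
      = ((B.card : ℝ) * ∑ i ∈ A, f i - (A.card : ℝ) * ∑ i ∈ B, f i)
        / Real.sqrt ((A.card : ℝ) * (B.card : ℝ)) := by
  have key (s : Finset (Fin n)) : ∑ i ∈ s, f i = ∑ i, f i * (if i ∈ s then (1 : ℝ) else 0) := by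
    simp [Finset.sum_ite_mem]
  rw [key A, key B, mul_sum, mul_sum, ← sum_sub_distrib, sum_div]
  refine sum_congr rfl fun i _ => ?_
  unfold stump
  ring

lemma sum_stump_mul_stump_of_const {A B C D : Finset (Fin n)} {c : ℝ}
    (h : ∀ i ∈ A ∪ B, stump C D i = c) :
    ∑ i, stump A B i * stump C D i = 0 := by
  simp_rw [mul_comm (stump A B _)]
  rw [sum_mul_stump, sum_congr rfl fun i hi => h i (mem_union_left B hi),
    sum_congr rfl fun i hi => h i (mem_union_right A hi)]
  simp only [sum_const, nsmul_eq_mul]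
  rw [div_eq_zero_iff]
  left
  ring

lemma stump_of_mem_left {A B : Finset (Fin n)} (h : Disjoint A B) {i : Fin n} (hi : i ∈ A) :
    stump A B i = (B.card : ℝ) / Real.sqrt ((A.card : ℝ) * (B.card : ℝ)) := by
  simp [stump, hi, disjoint_left.1 h hi]

lemma stump_of_mem_right {A B : Finset (Fin n)} (h : Disjoint A B) {i : Fin n} (hi : i ∈ B) :
    stump A B i = -(A.card : ℝ) / Real.sqrt ((A.card : ℝ) * (B.card : ℝ)) := by
  simp [stump, hi, disjoint_right.1 h hi]

lemma stump_of_notMem {A B : Finset (Fin n)} {i : Fin n} (hi : i ∉ A ∪ B) :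
    stump A B i = 0 := by
  rw [mem_union, not_or] at hi
  simp [stump, hi.1, hi.2]

lemma sum_stump_mul_stump_of_laminar {A B C D : Finset (Fin n)}
    (hAB : Disjoint A B) (hCD : Disjoint C D)
    (h : Disjoint (A ∪ B) (C ∪ D) ∨ A ∪ B ⊆ C ∨ A ∪ B ⊆ D ∨ C ∪ D ⊆ A ∨ C ∪ D ⊆ B) :
    ∑ i, stump A B i * stump C D i = 0 := by
  rcases h with h | h | h | h | h
  · exact sum_stump_mul_stump_of_const fun i hi => stump_of_notMem (disjoint_left.1 h hi)
  · exact sum_stump_mul_stump_of_const fun i hi => stump_of_mem_left hCD (h hi)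
  · exact sum_stump_mul_stump_of_const fun i hi => stump_of_mem_right hCD (h hi)
  · simp_rw [mul_comm (stump A B _)]
    exact sum_stump_mul_stump_of_const fun i hi => stump_of_mem_left hAB (h hi)
  · simp_rw [mul_comm (stump A B _)]
    exact sum_stump_mul_stump_of_const fun i hi => stump_of_mem_right hAB (h hi)

lemma sum_stump_mul_self {A B : Finset (Fin n)} (hA : A.Nonempty) (hB : B.Nonempty)
    (h : Disjoint A B) :
    ∑ i, stump A B i * stump A B i = ((A ∪ B).card : ℝ) := by
  have ha : (0 : ℝ) < A.card := by exact_mod_cast hA.card_pos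
  have hb : (0 : ℝ) < B.card := by exact_mod_cast hB.card_pos
  have hs := Real.sq_sqrt (mul_pos ha hb).le
  have hs0 := Real.sqrt_pos.2 (mul_pos ha hb)
  rw [sum_mul_stump, sum_congr rfl fun i hi => stump_of_mem_left h hi,
    sum_congr rfl fun i hi => stump_of_mem_right h hi, card_union_of_disjoint h]
  simp only [sum_const, nsmul_eq_mul]
  push_cast
  field_simp
  rw [mul_comm (B.card : ℝ), hs]
  ring

lemma sum_sub_nodeMean_sq (y : Fin n → ℝ) {v : Finset (Fin n)} (hv : v.Nonempty) :
    ∑ i ∈ v, (y i - nodeMean y v) ^ 2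
      = ∑ i ∈ v, y i ^ 2 - (∑ i ∈ v, y i) ^ 2 / (v.card : ℝ) := by
  have hc : (v.card : ℝ) ≠ 0 := by exact_mod_cast hv.card_pos.ne'
  simp only [sub_sq, sum_add_distrib, sum_sub_distrib, ← sum_mul, ← mul_sum, sum_const,
    nsmul_eq_mul, nodeMean]
  field_simp
  ring

lemma card_mul_impurityDecrease (y : Fin n → ℝ) {A B : Finset (Fin n)} (hA : A.Nonempty)
    (hB : B.Nonempty) (h : Disjoint A B) :
    ((A ∪ B).card : ℝ) * impurityDecrease y A B
      = (∑ i, y i * stump A B i) ^ 2 / ((A ∪ B).card : ℝ) := by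
  have ha : (0 : ℝ) < A.card := by exact_mod_cast hA.card_pos
  have hb : (0 : ℝ) < B.card := by exact_mod_cast hB.card_pos
  have hs := Real.sq_sqrt (mul_pos ha hb).le
  rw [impurityDecrease, sum_sub_nodeMean_sq y hA, sum_sub_nodeMean_sq y hB,
    sum_sub_nodeMean_sq y (hA.mono subset_union_left), sum_mul_stump, div_pow, hs,
    sum_union h, sum_union h, card_union_of_disjoint h]
  push_cast
  field_simp
  ring

theorem explained_ss_eq_total_weighted_impurity {m : ℕ} (y : Fin n → ℝ)
    (vL vR : Fin m → Finset (Fin n))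
    (hL : ∀ j, (vL j).Nonempty) (hR : ∀ j, (vR j).Nonempty)
    (hd : ∀ j, Disjoint (vL j) (vR j))
    (laminar : ∀ j j', j ≠ j' →
      Disjoint (vL j ∪ vR j) (vL j' ∪ vR j')
      ∨ (vL j ∪ vR j) ⊆ vL j' ∨ (vL j ∪ vR j) ⊆ vR j'
      ∨ (vL j' ∪ vR j') ⊆ vL j ∨ (vL j' ∪ vR j') ⊆ vR j) :
    let ybar := (n : ℝ)⁻¹ * ∑ i, y i
    let β := fun j => (∑ i, y i * stump (vL j) (vR j) i) / (((vL j ∪ vR j).card : ℝ))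
    let yhat := fun i => ybar + ∑ j, β j * stump (vL j) (vR j) i
    ∑ i, (yhat i - ybar) ^ 2
      = ∑ j, ((vL j ∪ vR j).card : ℝ) * impurityDecrease y (vL j) (vR j) := by
  intro ybar β yhat
  have horth (j k : Fin m) (hjk : k ≠ j) :
      β j * β k * ∑ i, stump (vL j) (vR j) i * stump (vL k) (vR k) i = 0 := by
    rw [sum_stump_mul_stump_of_laminar (hd j) (hd k) (laminar j k hjk.symm), mul_zero]
  calc ∑ i, (yhat i - ybar) ^ 2
      = ∑ j, ∑ k, β j * β k * ∑ i, stump (vL j) (vR j) i * stump (vL k) (vR k) i := by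
        simp only [yhat, add_sub_cancel_left, sq, sum_mul_sum]
        simp only [mul_sum]
        rw [sum_comm]
        refine sum_congr rfl fun j _ => ?_
        rw [sum_comm]
        exact sum_congr rfl fun k _ => sum_congr rfl fun i _ => by ring
    _ = ∑ j, ((vL j ∪ vR j).card : ℝ) * impurityDecrease y (vL j) (vR j) := by
        refine sum_congr rfl fun j _ => ?_
        have hc : ((vL j ∪ vR j).card : ℝ) ≠ 0 := by
          exact_mod_cast ((hL j).mono subset_union_left).card_pos.ne'
        rw [sum_eq_single j (fun k _ hk => horth j k hk) (by simp),
          sum_stump_mul_self (hL j) (hR j) (hd j),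
          card_mul_impurityDecrease y (hL j) (hR j) (hd j)]
        simp only [β]
        field_simp
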